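/- arXiv:1212.4756 — 2 statements merged into one kernel-verified Lean document; each statement's English description precedes it below -/
import Mathlib

section
/- For every positive integer k there exists a set {x_1, x_2, …, x_k} of k distinct integers, all lying in the range [1, 3k^5], such that for all indices a, b, c, d, e, f ∈ {1, …, k} the equation x_a + x_b + x_c = x_d + x_e + x_f holds if and only if it holds algebraically, i.e., if and only if the multisets {a, b, c} and {d, e, f} are equal. -/
/-- The three-term sums of elements of `S` are determined by the multiset of their terms. -/
def ThreeSumDetermined (S : Finset ℤ) : Prop :=
  ∀ s t : Multiset ℤ, s.card = 3 → t.card = 3 → (∀ x ∈ s, x ∈ S) → (∀ x ∈ t, x ∈ S) →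
    s.sum = t.sum → s = t

/-- The integers `y` solving an equation `m * y + (3 - m terms of S) = (3 terms of S)`
for some `m ∈ {1, 2, 3}`. -/
def threeSumObstruction (S : Finset ℤ) : Finset ℤ :=
  ((S ×ˢ S ×ˢ S ×ˢ S ×ˢ S).image fun p => p.1 + p.2.1 + p.2.2.1 - p.2.2.2.1 - p.2.2.2.2) ∪
  ((S ×ˢ S ×ˢ S ×ˢ S).image fun p => (p.1 + p.2.1 + p.2.2.1 - p.2.2.2) / 2) ∪
  ((S ×ˢ S ×ˢ S).image fun p => (p.1 + p.2.1 + p.2.2) / 3)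

theorem card_threeSumObstruction_le (S : Finset ℤ) :
    (threeSumObstruction S).card ≤ S.card ^ 5 + S.card ^ 4 + S.card ^ 3 := by
  unfold threeSumObstruction
  refine (Finset.card_union_le _ _).trans (add_le_add ((Finset.card_union_le _ _).trans
    (add_le_add ?_ ?_)) ?_) <;>
  · refine Finset.card_image_le.trans (le_of_eq ?_)
    simp only [Finset.card_product]
    ring

theorem mem_threeSumObstruction {S : Finset ℤ} {y : ℤ} {m : ℕ} {u v : Multiset ℤ}
    (hm : 0 < m) (hu : m + u.card = 3) (hv : v.card = 3) (huS : ∀ x ∈ u, x ∈ S)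
    (hvS : ∀ x ∈ v, x ∈ S) (h : m * y + u.sum = v.sum) : y ∈ threeSumObstruction S := by
  obtain ⟨c, d, e, rfl⟩ := Multiset.card_eq_three.1 hv
  simp only [Multiset.insert_eq_cons, Multiset.mem_cons, Multiset.mem_singleton,
    forall_eq_or_imp, forall_eq, Multiset.sum_cons, Multiset.sum_singleton] at hvS h
  obtain ⟨hc, hd, he⟩ := hvS
  unfold threeSumObstruction
  simp only [Finset.mem_union, Finset.mem_image, Finset.mem_product]
  obtain rfl | rfl | rfl : m = 1 ∨ m = 2 ∨ m = 3 := by omega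
  · obtain ⟨a, b, rfl⟩ := Multiset.card_eq_two.1 (show u.card = 2 by omega)
    simp only [Multiset.insert_eq_cons, Multiset.mem_cons, Multiset.mem_singleton,
      forall_eq_or_imp, forall_eq, Multiset.sum_cons, Multiset.sum_singleton] at huS h
    exact .inl (.inl ⟨(c, d, e, a, b), ⟨hc, hd, he, huS.1, huS.2⟩, by push_cast at h; grind⟩)
  · obtain ⟨a, rfl⟩ := Multiset.card_eq_one.1 (show u.card = 1 by omega)
    simp only [Multiset.mem_singleton, forall_eq, Multiset.sum_singleton] at huS h
    exact .inl (.inr ⟨(c, d, e, a), ⟨hc, hd, he, huS⟩, by push_cast at h; simp only; omega⟩)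
  · obtain rfl := Multiset.card_eq_zero.1 (show u.card = 0 by omega)
    simp only [Multiset.sum_zero] at h
    exact .inr ⟨(c, d, e), ⟨hc, hd, he⟩, by push_cast at h; simp only; omega⟩

theorem Multiset.exists_eq_replicate_add_of_mem_insert {α : Type*} [DecidableEq α] {S : Finset α}
    {y : α} {s : Multiset α} (hs : ∀ x ∈ s, x ∈ insert y S) :
    ∃ (i : ℕ) (s' : Multiset α), s = Multiset.replicate i y + s' ∧ ∀ x ∈ s', x ∈ S := by
  refine ⟨s.count y, s.filter (· ≠ y), ?_, fun x hx => ?_⟩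
  · rw [← Multiset.filter_eq', Multiset.filter_add_not]
  · rw [Multiset.mem_filter] at hx
    exact Finset.mem_of_mem_insert_of_ne (hs x hx.1) hx.2

theorem Multiset.forall_mem_replicate_add {α : Type*} {S : Finset α} {z : α} (hz : z ∈ S) (n : ℕ)
    {s : Multiset α} (hs : ∀ x ∈ s, x ∈ S) : ∀ x ∈ Multiset.replicate n z + s, x ∈ S := by
  intro x hx
  obtain hx | hx := Multiset.mem_add.1 hx
  · exact Multiset.eq_of_mem_replicate hx ▸ hz
  · exact hs x hx

theorem notMem_of_notMem_threeSumObstruction {S : Finset ℤ} {y : ℤ}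
    (hy : y ∉ threeSumObstruction S) : y ∉ S := fun hyS =>
  hy (mem_threeSumObstruction (m := 1) (u := {y, y}) (v := {y, y, y}) one_pos rfl rfl
    (by simpa) (by simpa) (by simp))

theorem ThreeSumDetermined.insert {S : Finset ℤ} (hS : ThreeSumDetermined S) (hne : S.Nonempty)
    {y : ℤ} (hy : y ∉ threeSumObstruction S) : ThreeSumDetermined (insert y S) := by
  obtain ⟨z, hz⟩ := hne
  intro s t hs ht hsy hty h
  obtain ⟨i, s, rfl, hsS⟩ := Multiset.exists_eq_replicate_add_of_mem_insert hsy
  obtain ⟨j, t, rfl, htS⟩ := Multiset.exists_eq_replicate_add_of_mem_insert hty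
  clear hsy hty
  wlog hij : j ≤ i generalizing i j s t
  · exact (this j t htS ht i s hsS hs h.symm (le_of_not_ge hij)).symm
  obtain ⟨m, rfl⟩ := Nat.exists_eq_add_of_le hij
  simp only [Multiset.card_add, Multiset.card_replicate, Multiset.sum_add,
    Multiset.sum_replicate, nsmul_eq_mul] at hs ht h
  push_cast at h
  obtain rfl | hm := Nat.eq_zero_or_pos m
  · have := hS (Multiset.replicate j z + s) (Multiset.replicate j z + t) (by simpa using hs)
      (by simpa using ht) (Multiset.forall_mem_replicate_add hz j hsS)
      (Multiset.forall_mem_replicate_add hz j htS) (by simpa using h)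
    simp [add_left_cancel this]
  · refine absurd (mem_threeSumObstruction hm (u := Multiset.replicate j z + s)
      (v := Multiset.replicate j z + t) ?_ ?_ (Multiset.forall_mem_replicate_add hz j hsS)
      (Multiset.forall_mem_replicate_add hz j htS) ?_) hy
    · simp only [Multiset.card_add, Multiset.card_replicate]; omega
    · simpa using ht
    · simp only [Multiset.sum_add, Multiset.sum_replicate, nsmul_eq_mul]
      linear_combination h

theorem threeSumDetermined_singleton (a : ℤ) : ThreeSumDetermined {a} := by
  intro s t hs ht hsa hta _
  simp only [Finset.mem_singleton] at hsa hta
  rw [Multiset.eq_replicate.2 ⟨hs, hsa⟩, Multiset.eq_replicate.2 ⟨ht, hta⟩]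

theorem exists_threeSumDetermined_card_eq (k : ℕ) (hk : 0 < k) :
    ∃ S ⊆ Finset.Icc (1 : ℤ) (3 * (k : ℤ) ^ 5), S.card = k ∧ ThreeSumDetermined S := by
  suffices H : ∀ n, 1 ≤ n → n ≤ k →
      ∃ S ⊆ Finset.Icc (1 : ℤ) (3 * (k : ℤ) ^ 5), S.card = n ∧ ThreeSumDetermined S from
    H k hk le_rfl
  intro n hn
  induction n, hn using Nat.le_induction with
  | base =>
    intro _
    refine ⟨{1}, ?_, rfl, threeSumDetermined_singleton 1⟩
    have : 0 < (k : ℤ) ^ 5 := by positivity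
    rw [Finset.singleton_subset_iff, Finset.mem_Icc]
    omega
  | succ n hn ih =>
    intro hnk
    obtain ⟨S, hSI, hcard, hS⟩ := ih (by omega)
    have hlt : (threeSumObstruction S).card < (Finset.Icc (1 : ℤ) (3 * (k : ℤ) ^ 5)).card := by
      have hIcc : (Finset.Icc (1 : ℤ) (3 * (k : ℤ) ^ 5)).card = 3 * k ^ 5 := by
        rw [Int.card_Icc, add_sub_cancel_right]
        exact_mod_cast Int.toNat_natCast (3 * k ^ 5)
      have hle := card_threeSumObstruction_le S
      have h4 : n ^ 4 ≤ n ^ 5 := Nat.pow_le_pow_right hn (by norm_num)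
      have h3 : n ^ 3 ≤ n ^ 5 := Nat.pow_le_pow_right hn (by norm_num)
      have h5 : n ^ 5 < k ^ 5 := Nat.pow_lt_pow_left (by omega) (by norm_num)
      rw [hcard] at hle
      omega
    obtain ⟨y, hyI, hy⟩ := Finset.exists_mem_notMem_of_card_lt_card hlt
    refine ⟨insert y S, Finset.insert_subset hyI hSI, ?_,
      hS.insert (Finset.card_pos.1 (by omega)) hy⟩
    rw [Finset.card_insert_of_notMem (notMem_of_notMem_threeSumObstruction hy), hcard]

/-- For every positive integer `k` there is a family of `k`
distinct integers, all in the range `[1, 3k^5]`, such that a three-term sum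
equation `x a + x b + x c = x d + x e + x f` holds iff it holds algebraically,
i.e. iff the index multisets `{a,b,c}` and `{d,e,f}` coincide. -/
theorem exists_threeSum_determined_family (k : ℕ) (hk : 0 < k) :
    ∃ x : Fin k → ℤ, Function.Injective x ∧
      (∀ i, 1 ≤ x i ∧ x i ≤ 3 * (k : ℤ) ^ 5) ∧
      (∀ a b c d e f : Fin k,
        x a + x b + x c = x d + x e + x f ↔
          ({a, b, c} : Multiset (Fin k)) = ({d, e, f} : Multiset (Fin k))) := by
  obtain ⟨S, hSI, hcard, hS⟩ := exists_threeSumDetermined_card_eq k hk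
  have hinj := (S.orderEmbOfFin hcard).injective
  have hmem := S.orderEmbOfFin_mem hcard
  refine ⟨S.orderEmbOfFin hcard, hinj, fun i => Finset.mem_Icc.1 (hSI (hmem i)), ?_⟩
  intro a b c d e f
  rw [← (Multiset.map_injective hinj).eq_iff]
  simp only [Multiset.insert_eq_cons, Multiset.map_cons, Multiset.map_singleton]
  constructor
  · intro h
    exact hS _ _ rfl rfl (by simp [hmem]) (by simp [hmem]) (by simpa [add_assoc] using h)
  · intro h
    simpa [add_assoc] using congrArg Multiset.sum h
end

section
/- Let S ⊆ ℝ² be a nonempty bounded set and let u, v ∈ ℝ² be linearly independent. Then for each w ∈ {0, u, v, u + v}, the translate S + w is not contained in the convex hull of the union of the other three translates; in particular, S + (u + v) contains a point outside the convex hull of S ∪ (S + u) ∪ (S + v). -/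
/-- A linear functional takes arbitrary prescribed values on two linearly independent vectors. -/
theorem LinearIndependent.exists_continuousLinearMap_pair_eq
    {E : Type*} [NormedAddCommGroup E] [NormedSpace ℝ E] [FiniteDimensional ℝ E] {u v : E}
    (hli : LinearIndependent ℝ ![u, v]) (a b : ℝ) :
    ∃ f : E →L[ℝ] ℝ, f u = a ∧ f v = b := by
  obtain ⟨g, hg⟩ := ((Module.Basis.span hli).constr ℝ ![a, b]).exists_extend
  have key (i : Fin 2) : g (![u, v] i) = ![a, b] i := by
    have h := LinearMap.congr_fun hg (Module.Basis.span hli i)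
    rw [Module.Basis.constr_basis] at h
    rw [← h, LinearMap.comp_apply, Submodule.subtype_apply, Module.Basis.span_apply]
  exact ⟨LinearMap.toContinuousLinearMap g, key 0, key 1⟩

/-- If a continuous linear functional separates `w` from `T` by a positive gap, then some point of
the translate `S + w` lies outside the convex hull of the translates of `S` by elements of `T`. -/
theorem exists_mem_translate_notMem_convexHull_biUnion
    {E : Type*} [NormedAddCommGroup E] [NormedSpace ℝ E] {S T : Set E} {w : E} {c : ℝ}
    (hne : S.Nonempty) (hbdd : Bornology.IsBounded S) (f : E →L[ℝ] ℝ)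
    (hT : ∀ t ∈ T, f t ≤ c) (hw : c < f w) :
    ∃ p ∈ (fun x => x + w) '' S, p ∉ convexHull ℝ (⋃ t ∈ T, (fun x => x + t) '' S) := by
  have hbdd' : BddAbove (f '' S) := (f.lipschitz.isBounded_image hbdd).bddAbove
  obtain ⟨_, ⟨x, hx, rfl⟩, hlt⟩ :=
    exists_lt_of_lt_csSup (hne.image f) (sub_lt_self (sSup (f '' S)) (sub_pos.2 hw))
  refine ⟨x + w, ⟨x, hx, rfl⟩, fun hmem => ?_⟩
  have hsub : (⋃ t ∈ T, (fun x => x + t) '' S) ⊆ {y | f y ≤ sSup (f '' S) + c} := by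
    simp only [Set.iUnion_subset_iff]
    rintro t ht _ ⟨y, hy, rfl⟩
    simpa using add_le_add (le_csSup hbdd' (Set.mem_image_of_mem f hy)) (hT t ht)
  have hle := convexHull_min hsub (convex_halfSpace_le f.isLinear _) hmem
  rw [Set.mem_ofPred_eq, map_add] at hle
  linarith

/-- For a nonempty bounded `S ⊆ ℝ²` and linearly independent
`u, v`, each of the four translates of `S` by `0, u, v, u + v` is not contained
in the convex hull of the union of the other three; in particular
`S + (u + v)` contains a point outside the convex hull of
`S ∪ (S + u) ∪ (S + v)`. -/
theorem translate_not_subset_convexHull_of_others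
    (S : Set (EuclideanSpace ℝ (Fin 2))) (u v : EuclideanSpace ℝ (Fin 2))
    (hne : S.Nonempty) (hbdd : Bornology.IsBounded S)
    (hli : LinearIndependent ℝ ![u, v]) :
    (∀ w ∈ ({0, u, v, u + v} : Set (EuclideanSpace ℝ (Fin 2))),
      ¬ ((fun x => x + w) '' S ⊆
          convexHull ℝ (⋃ w' ∈ ({0, u, v, u + v} : Set (EuclideanSpace ℝ (Fin 2))) \ {w},
            (fun x => x + w') '' S))) ∧
    (∃ p ∈ (fun x => x + (u + v)) '' S,
      p ∉ convexHull ℝ (S ∪ (fun x => x + u) '' S ∪ (fun x => x + v) '' S)) := by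
  have separate (w : EuclideanSpace ℝ (Fin 2)) (hw : w = 0 ∨ w = u ∨ w = v ∨ w = u + v) :
      ∃ f : EuclideanSpace ℝ (Fin 2) →L[ℝ] ℝ,
        ∀ t ∈ ({0, u, v, u + v} : Set (EuclideanSpace ℝ (Fin 2))) \ {w}, f t ≤ f w - 1 := by
    rcases hw with rfl | rfl | rfl | rfl
    · obtain ⟨f, hu, hv⟩ := hli.exists_continuousLinearMap_pair_eq (-1) (-1)
      refine ⟨f, ?_⟩
      rintro t ⟨rfl | rfl | rfl | rfl, ht⟩ <;> first | exact absurd rfl ht | norm_num [hu, hv]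
    · obtain ⟨f, hu, hv⟩ := hli.exists_continuousLinearMap_pair_eq 1 (-1)
      refine ⟨f, ?_⟩
      rintro t ⟨rfl | rfl | rfl | rfl, ht⟩ <;> first | exact absurd rfl ht | norm_num [hu, hv]
    · obtain ⟨f, hu, hv⟩ := hli.exists_continuousLinearMap_pair_eq (-1) 1
      refine ⟨f, ?_⟩
      rintro t ⟨rfl | rfl | rfl | rfl, ht⟩ <;> first | exact absurd rfl ht | norm_num [hu, hv]
    · obtain ⟨f, hu, hv⟩ := hli.exists_continuousLinearMap_pair_eq 1 1
      refine ⟨f, ?_⟩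
      rintro t ⟨rfl | rfl | rfl | rfl, ht⟩ <;> first | exact absurd rfl ht | norm_num [hu, hv]
  refine ⟨fun w hw hsub => ?_, ?_⟩
  · obtain ⟨f, hf⟩ := separate w hw
    obtain ⟨p, hp, hp'⟩ :=
      exists_mem_translate_notMem_convexHull_biUnion hne hbdd f hf (sub_one_lt (f w))
    exact hp' (hsub hp)
  · obtain ⟨f, hu, hv⟩ := hli.exists_continuousLinearMap_pair_eq 1 1
    have hT : ∀ t ∈ ({0, u, v} : Set (EuclideanSpace ℝ (Fin 2))), f t ≤ 1 := by
      rintro t (rfl | rfl | rfl) <;> norm_num [hu, hv]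
    simpa [Set.biUnion_insert, Set.union_assoc] using
      exists_mem_translate_notMem_convexHull_biUnion (w := u + v) hne hbdd f hT
        (by norm_num [hu, hv])
end
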